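/- For every ancestral graph H and disjoint subsets M and C of its node set, the graph α_AG(H;M,C) generated by the AG-generating algorithm is an ancestral graph. -/

import Mathlib

/-!
Stable mixed graphs: mixed graphs with arrows, arcs and lines; ribbonless,
summary and ancestral graphs; the generating maps α_RG, α_SG, α_AG;
m-connecting paths, m-separation and induced independence models.
-/

namespace StableMixedGraphs

/-- A mixed graph on node type `V`: a node set together with three edge
relations: arrows (`arrow i j` means an arrow from `i` to `j`), arcs
(two-headed, symmetric) and lines (undirected, symmetric). -/
structure MixedGraph (V : Type) where
  nodes : Set V
  arrow : V → V → Prop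
  arc : V → V → Prop
  line : V → V → Prop

namespace MixedGraph

variable {V W : Type}

/-- Wellformedness: arcs and lines are symmetric relations and all edges join
nodes of the graph. -/
def Wf (G : MixedGraph V) : Prop :=
  (∀ i j, G.arc i j → G.arc j i) ∧
  (∀ i j, G.line i j → G.line j i) ∧
  (∀ i j, G.arrow i j ∨ G.arc i j ∨ G.line i j → i ∈ G.nodes ∧ j ∈ G.nodes)

/-- No loops of any of the three kinds. -/
def Loopless (G : MixedGraph V) : Prop :=
  ∀ i, ¬ G.arrow i i ∧ ¬ G.arc i i ∧ ¬ G.line i i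

/-- A loopless mixed graph with a finite node set. -/
def IsLMG (G : MixedGraph V) : Prop := G.Wf ∧ G.Loopless ∧ G.nodes.Finite

/-- `G.anc i j` : `i` is an ancestor of `j`, i.e. there is a
direction-preserving path from `i` to `j`. -/
def anc (G : MixedGraph V) (i j : V) : Prop := Relation.TransGen G.arrow i j

/-- The set of ancestors of nodes of `C`. -/
def anSet (G : MixedGraph V) (C : Set V) : Set V := {a | ∃ c ∈ C, G.anc a c}

/-- `i` lies on a direction-preserving cycle. -/
def OnDPCycle (G : MixedGraph V) (i : V) : Prop := G.anc i i

/-- `i` is an endpoint of a line. -/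
def LineEndpoint (G : MixedGraph V) (i : V) : Prop := ∃ j, G.line i j

/-- Condition (2) of a ribbon: `i` or a descendant of `i` is an endpoint of a
line or lies on a direction-preserving cycle. -/
def RibbonTail (G : MixedGraph V) (i : V) : Prop :=
  ∃ d, (d = i ∨ G.anc i d) ∧ (G.LineEndpoint d ∨ G.OnDPCycle d)

/-- `G` contains a ribbon: a collider V-configuration `⟨h,i,j⟩` with no
endpoint-identical edge between `h` and `j`, whose inner node `i` (or a
descendant of it) is an endpoint of a line or on a direction-preserving
cycle. -/
def HasRibbon (G : MixedGraph V) : Prop :=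
  ∃ h i j, h ≠ i ∧ i ≠ j ∧ h ≠ j ∧ G.RibbonTail i ∧
    ((G.arc h i ∧ G.arc i j ∧ ¬ G.arc h j) ∨
     (G.arrow h i ∧ G.arrow j i ∧ ¬ G.line h j) ∨
     (G.arrow h i ∧ G.arc i j ∧ ¬ G.arrow h j))

/-- A ribbonless graph: a loopless mixed graph with no ribbon. -/
def IsRG (G : MixedGraph V) : Prop := G.IsLMG ∧ ¬ G.HasRibbon

/-- A directed acyclic graph: only arrows, no direction-preserving cycle. -/
def IsDAG (G : MixedGraph V) : Prop :=
  G.IsLMG ∧ (∀ i j, ¬ G.arc i j) ∧ (∀ i j, ¬ G.line i j) ∧ ∀ i, ¬ G.anc i i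

/-- A summary graph: a loopless mixed graph with no arrowhead pointing to an
endpoint of a line and no direction-preserving cycle. -/
def IsSG (G : MixedGraph V) : Prop :=
  G.IsLMG ∧ (∀ i, G.LineEndpoint i → ∀ k, ¬ G.arrow k i ∧ ¬ G.arc k i) ∧
    ∀ i, ¬ G.anc i i

/-- A simple mixed graph: no loops and no multiple edges. -/
def Simple (G : MixedGraph V) : Prop :=
  G.Loopless ∧ ∀ i j,
    (G.arrow i j → ¬ G.arrow j i ∧ ¬ G.arc i j ∧ ¬ G.line i j) ∧
    (G.arc i j → ¬ G.line i j)

/-- An ancestral graph: a simple mixed graph such that no node is an ancestor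
of one of its parents or spouses, and a node with a neighbour has neither
parents nor spouses. -/
def IsAG (G : MixedGraph V) : Prop :=
  G.Wf ∧ G.Simple ∧ G.nodes.Finite ∧
  (∀ i j, G.arrow j i ∨ G.arc j i → ¬ G.anc i j) ∧
  (∀ i, G.LineEndpoint i → ∀ k, ¬ G.arrow k i ∧ ¬ G.arc k i)

/-- An undirected graph: only lines. -/
def IsUG (G : MixedGraph V) : Prop :=
  G.IsLMG ∧ (∀ i j, ¬ G.arrow i j) ∧ ∀ i j, ¬ G.arc i j

/-- A bidirected graph: only arcs. -/
def IsBG (G : MixedGraph V) : Prop :=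
  G.IsLMG ∧ (∀ i j, ¬ G.arrow i j) ∧ ∀ i j, ¬ G.line i j

/-- Image of a mixed graph under a map of node types. -/
def map (f : V → W) (G : MixedGraph V) : MixedGraph W where
  nodes := f '' G.nodes
  arrow a b := ∃ i j, G.arrow i j ∧ f i = a ∧ f j = b
  arc a b := ∃ i j, G.arc i j ∧ f i = a ∧ f j = b
  line a b := ∃ i j, G.line i j ∧ f i = a ∧ f j = b

end MixedGraph

/-! ### The closure generating new edges (Table 1 of the RG-generating
algorithm), for given marginalisation set `M` and collider set
`S = C ∪ an(C)`.  For every V-configuration whose inner node is a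
non-collider in `M` (rows 1–7) or a collider in `S` (rows 8–10) the
endpoint-identical edge between the endpoints is generated, repeatedly
until closure. -/

mutual
  /-- Generated arrows (`GenArrow H M S j i`: arrow from `j` to `i`). -/
  inductive GenArrow {V : Type} (H : MixedGraph V) (M S : Set V) : V → V → Prop
    | base {i j : V} : H.arrow i j → GenArrow H M S i j
    | row1 {i j m : V} : m ∈ M → j ≠ i →
        GenArrow H M S j m → GenArrow H M S m i → GenArrow H M S j i
    | row2 {i j m : V} : m ∈ M → j ≠ i →
        GenLine H M S j m → GenArrow H M S m i → GenArrow H M S j i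
    | row3 {i j m : V} : m ∈ M → j ≠ i →
        GenLine H M S j m → GenArc H M S m i → GenArrow H M S j i
    | row8 {i j s : V} : s ∈ S → j ≠ i →
        GenArrow H M S j s → GenArc H M S s i → GenArrow H M S j i

  /-- Generated arcs. -/
  inductive GenArc {V : Type} (H : MixedGraph V) (M S : Set V) : V → V → Prop
    | base {i j : V} : H.arc i j → GenArc H M S i j
    | symm {i j : V} : GenArc H M S i j → GenArc H M S j i
    | row4 {i j m : V} : m ∈ M → i ≠ j →
        GenArrow H M S m i → GenArrow H M S m j → GenArc H M S i j
    | row5 {i j m : V} : m ∈ M → i ≠ j →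
        GenArrow H M S m i → GenArc H M S m j → GenArc H M S i j
    | row9 {i j s : V} : s ∈ S → i ≠ j →
        GenArc H M S i s → GenArc H M S s j → GenArc H M S i j

  /-- Generated lines. -/
  inductive GenLine {V : Type} (H : MixedGraph V) (M S : Set V) : V → V → Prop
    | base {i j : V} : H.line i j → GenLine H M S i j
    | symm {i j : V} : GenLine H M S i j → GenLine H M S j i
    | row6 {i j m : V} : m ∈ M → i ≠ j →
        GenLine H M S i m → GenArrow H M S j m → GenLine H M S i j
    | row7 {i j m : V} : m ∈ M → i ≠ j →
        GenLine H M S i m → GenLine H M S m j → GenLine H M S i j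
    | row10 {i j s : V} : s ∈ S → i ≠ j →
        GenArrow H M S i s → GenArrow H M S j s → GenLine H M S i j
end

variable {V : Type}

/-- The RG-generating map `α_RG(H;M,C)`: generate all edges of the closure
and delete the nodes of `M ∪ C`. -/
def alphaRG (H : MixedGraph V) (M C : Set V) : MixedGraph V where
  nodes := H.nodes \ (M ∪ C)
  arrow i j := i ∈ H.nodes \ (M ∪ C) ∧ j ∈ H.nodes \ (M ∪ C) ∧
    GenArrow H M (C ∪ H.anSet C) i j
  arc i j := i ∈ H.nodes \ (M ∪ C) ∧ j ∈ H.nodes \ (M ∪ C) ∧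
    GenArc H M (C ∪ H.anSet C) i j
  line i j := i ∈ H.nodes \ (M ∪ C) ∧ j ∈ H.nodes \ (M ∪ C) ∧
    GenLine H M (C ∪ H.anSet C) i j

/-- The arrowhead-removal operation `α_RG.SG(K;A)`: every arrowhead pointing
at a node of `A` is removed (an arrow at such a node becomes a line, an arc
becomes an arrow, an arc with both endpoints in `A` becomes a line),
repeatedly until closure. -/
def deheadAt (K : MixedGraph V) (A : Set V) : MixedGraph V where
  nodes := K.nodes
  arrow j i := i ∉ A ∧ (K.arrow j i ∨ (K.arc j i ∧ j ∈ A))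
  arc i j := K.arc i j ∧ i ∉ A ∧ j ∉ A
  line i j := K.line i j ∨ (K.arrow j i ∧ i ∈ A) ∨ (K.arrow i j ∧ j ∈ A) ∨
    (K.arc i j ∧ i ∈ A ∧ j ∈ A)

/-- The SG-generating map `α_SG(H;M,C)`: mark the nodes of `an(C)`, apply the
RG-generating construction, then remove all arrowheads pointing at marked
nodes. -/
def alphaSG (H : MixedGraph V) (M C : Set V) : MixedGraph V :=
  deheadAt (alphaRG H M C) (H.anSet C)

/-! ### Step 2 of the AG-generating algorithm: for every V-configuration
`j → k ↔ i` or `j ↔ k ↔ i` with `k ∈ an(i)` (in the current graph) generate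
an arrow from `j` to `i`, respectively an arc between `j` and `i`, until
closure. -/

mutual
  inductive AG2Arrow {V : Type} (K : MixedGraph V) : V → V → Prop
    | base {i j : V} : K.arrow j i → AG2Arrow K j i
    | gen {i j k : V} : j ≠ i → AG2Arrow K j k → AG2Arc K k i →
        AG2Anc K k i → AG2Arrow K j i

  inductive AG2Arc {V : Type} (K : MixedGraph V) : V → V → Prop
    | base {i j : V} : K.arc i j → AG2Arc K i j
    | symm {i j : V} : AG2Arc K i j → AG2Arc K j i
    | gen {i j k : V} : j ≠ i → AG2Arc K j k → AG2Arc K k i →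
        AG2Anc K k i → AG2Arc K j i

  /-- The ancestor relation of the graph being generated in step 2. -/
  inductive AG2Anc {V : Type} (K : MixedGraph V) : V → V → Prop
    | single {i j : V} : AG2Arrow K i j → AG2Anc K i j
    | tail {i k j : V} : AG2Arrow K i k → AG2Anc K k j → AG2Anc K i j
end

/-- The graph after step 2 of the AG-generating algorithm. -/
def ag2 (K : MixedGraph V) : MixedGraph V where
  nodes := K.nodes
  arrow := AG2Arrow K
  arc := AG2Arc K
  line := K.line

/-! ### Step 3 of the AG-generating algorithm: repeatedly replace every arc
between `j` and `i` with `j ∈ an(i)` (in the current graph) by an arrow from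
`j` to `i`. -/

mutual
  inductive AG3Arrow {V : Type} (K : MixedGraph V) : V → V → Prop
    | base {i j : V} : K.arrow j i → AG3Arrow K j i
    | conv {i j : V} : K.arc j i → AG3Anc K j i → AG3Arrow K j i

  /-- The ancestor relation of the graph being generated in step 3. -/
  inductive AG3Anc {V : Type} (K : MixedGraph V) : V → V → Prop
    | single {i j : V} : AG3Arrow K i j → AG3Anc K i j
    | tail {i k j : V} : AG3Arrow K i k → AG3Anc K k j → AG3Anc K i j
end

/-- Steps 2 and 3 of the AG-generating algorithm, applied to a summary
graph: `α_SG.AG`. -/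
def alphaSGAG (K : MixedGraph V) : MixedGraph V :=
  let K2 := ag2 K
  { nodes := K.nodes
    arrow := AG3Arrow K2
    arc := fun i j => K2.arc i j ∧ ¬ AG3Anc K2 i j ∧ ¬ AG3Anc K2 j i
    line := K.line }

/-- The AG-generating map `α_AG(H;M,C)`. -/
def alphaAG (H : MixedGraph V) (M C : Set V) : MixedGraph V :=
  alphaSGAG (alphaSG H M C)

/-! ### Paths, m-connection and m-separation. -/

/-- A step of a walk: it goes from `src` to `tgt` along an edge which has an
arrowhead at `src` iff `hs = true` and an arrowhead at `tgt` iff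
`ht = true` (so `hs = ht = false` is a line, `hs = ht = true` an arc, and
exactly one head an arrow in the corresponding direction). -/
structure Step (V : Type) where
  src : V
  tgt : V
  hs : Bool
  ht : Bool

/-- The edge of a step is present in `G`. -/
def Step.valid (G : MixedGraph V) (s : Step V) : Prop :=
  match s.hs, s.ht with
  | false, false => G.line s.src s.tgt
  | false, true  => G.arrow s.src s.tgt
  | true,  false => G.arrow s.tgt s.src
  | true,  true  => G.arc s.src s.tgt

/-- `w` is a path from `i` to `j` in `G`: a nonempty chained list of valid
steps with no repeated nodes. -/
def IsPath (G : MixedGraph V) (i j : V) (w : List (Step V)) : Prop :=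
  w ≠ [] ∧ (∀ s ∈ w, s.valid G) ∧ List.Chain' (fun a b => a.tgt = b.src) w ∧
    w.head?.map Step.src = some i ∧ w.getLast?.map Step.tgt = some j ∧
    (i :: w.map Step.tgt).Nodup

/-- The path `w` is m-connecting given `M` and `C`: every inner collider node
is in `C ∪ an(C)` and every inner non-collider node is in `M`. -/
def MConnPath (G : MixedGraph V) (M C : Set V) (w : List (Step V)) : Prop :=
  List.Chain'
    (fun a b =>
      (a.ht = true ∧ b.hs = true → a.tgt ∈ C ∪ G.anSet C) ∧
      (¬ (a.ht = true ∧ b.hs = true) → a.tgt ∈ M)) w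

/-- `A ⊥_m B | C` in `G` : there is no m-connecting path between `A` and `B`
given `C` (with `M` the remaining nodes). -/
def MSep (G : MixedGraph V) (A B C : Set V) : Prop :=
  ∀ i ∈ A, ∀ j ∈ B, ∀ w : List (Step V),
    IsPath G i j w → ¬ MConnPath G (G.nodes \ (A ∪ B ∪ C)) C w

/-- The independence model induced by `G` via m-separation: the set of
triples `⟨A,B|C⟩` of pairwise disjoint subsets of the nodes with
`A ⊥_m B | C`. -/
def Jm (G : MixedGraph V) : Set (Set V × Set V × Set V) :=
  {t | t.1 ⊆ G.nodes ∧ t.2.1 ⊆ G.nodes ∧ t.2.2 ⊆ G.nodes ∧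
    Disjoint t.1 t.2.1 ∧ Disjoint t.1 t.2.2 ∧ Disjoint t.2.1 t.2.2 ∧
    MSep G t.1 t.2.1 t.2.2}

/-- The independence model after marginalisation over `M` and conditioning on
`C` : `α(J;M,C)`. -/
def alphaIM (J : Set (Set V × Set V × Set V)) (M C : Set V) :
    Set (Set V × Set V × Set V) :=
  {t | (t.1, t.2.1, t.2.2 ∪ C) ∈ J ∧ (t.1 ∪ t.2.1 ∪ t.2.2) ∩ (M ∪ C) = ∅}

namespace MixedGraph

/-- Some edge of `G` has an arrowhead at `i`. -/
def HasHead (G : MixedGraph V) (i : V) : Prop := ∃ k, G.arrow k i ∨ G.arc k i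

theorem IsAG.not_anc_self {G : MixedGraph V} (hG : G.IsAG) (i : V) : ¬ G.anc i i := by
  intro h
  obtain ⟨-, hS, -, hA, -⟩ := hG
  rcases Relation.TransGen.tail'_iff.1 h with ⟨j, hij, hji⟩
  rcases Relation.reflTransGen_iff_eq_or_transGen.1 hij with rfl | hij
  · exact (hS.1 j).1 hji
  · exact hA i j (Or.inl hji) hij

theorem IsAG.not_hasHead_of_lineEndpoint {G : MixedGraph V} (hG : G.IsAG) {i : V}
    (hi : G.LineEndpoint i) : ¬ G.HasHead i := by
  rintro ⟨k, hk⟩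
  have := hG.2.2.2.2 i hi k
  tauto

theorem mem_anSet_of_anc {G : MixedGraph V} {C : Set V} {i j : V} (hij : G.anc i j)
    (hj : j ∈ C ∪ G.anSet C) : i ∈ C ∪ G.anSet C := by
  rcases hj with hj | ⟨c, hc, hjc⟩
  · exact Or.inr ⟨j, hj, hij⟩
  · exact Or.inr ⟨c, hc, hij.trans hjc⟩

end MixedGraph

open MixedGraph

/-! ### Edges of the closure -/

mutual
  theorem GenArrow.ne {H : MixedGraph V} {M S : Set V} (hL : H.Loopless) {i j : V} :
      GenArrow H M S i j → i ≠ j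
    | .base h => by rintro rfl; exact (hL _).1 h
    | .row1 _ h _ _ => h
    | .row2 _ h _ _ => h
    | .row3 _ h _ _ => h
    | .row8 _ h _ _ => h

  theorem GenArc.ne {H : MixedGraph V} {M S : Set V} (hL : H.Loopless) {i j : V} :
      GenArc H M S i j → i ≠ j
    | .base h => by rintro rfl; exact (hL _).2.1 h
    | .symm h => (GenArc.ne hL h).symm
    | .row4 _ h _ _ => h
    | .row5 _ h _ _ => h
    | .row9 _ h _ _ => h

  theorem GenLine.ne {H : MixedGraph V} {M S : Set V} (hL : H.Loopless) {i j : V} :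
      GenLine H M S i j → i ≠ j
    | .base h => by rintro rfl; exact (hL _).2.2 h
    | .symm h => (GenLine.ne hL h).symm
    | .row6 _ h _ _ => h
    | .row7 _ h _ _ => h
    | .row10 _ h _ _ => h
end

mutual
  theorem GenArrow.hasHead {H : MixedGraph V} {M S : Set V} (hW : H.Wf) {i j : V} :
      GenArrow H M S i j → H.HasHead j
    | .base h => ⟨_, Or.inl h⟩
    | .row1 _ _ _ h => GenArrow.hasHead hW h
    | .row2 _ _ _ h => GenArrow.hasHead hW h
    | .row3 _ _ _ h => (GenArc.hasHead hW h).2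
    | .row8 _ _ _ h => (GenArc.hasHead hW h).2

  theorem GenArc.hasHead {H : MixedGraph V} {M S : Set V} (hW : H.Wf) {i j : V} :
      GenArc H M S i j → H.HasHead i ∧ H.HasHead j
    | .base h => ⟨⟨_, Or.inr (hW.1 _ _ h)⟩, ⟨_, Or.inr h⟩⟩
    | .symm h => (GenArc.hasHead hW h).symm
    | .row4 _ _ h₁ h₂ => ⟨GenArrow.hasHead hW h₁, GenArrow.hasHead hW h₂⟩
    | .row5 _ _ h₁ h₂ => ⟨GenArrow.hasHead hW h₁, (GenArc.hasHead hW h₂).2⟩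
    | .row9 _ _ h₁ h₂ => ⟨(GenArc.hasHead hW h₁).1, (GenArc.hasHead hW h₂).2⟩
end

section TailEndpoints

variable {H : MixedGraph V} {M C : Set V}

theorem mem_of_anc_of_hasHead (hH : H.IsAG) {i j : V}
    (hj : H.HasHead j) (hi : H.LineEndpoint i ∨ i ∈ C ∪ H.anSet C ∨ H.anc i j)
    (hj' : H.LineEndpoint j ∨ j ∈ C ∪ H.anSet C) :
    H.LineEndpoint i ∨ i ∈ C ∪ H.anSet C := by
  rcases hi with hi | hi | hi
  · exact Or.inl hi
  · exact Or.inr hi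
  · exact hj'.elim (fun h => absurd hj (hH.not_hasHead_of_lineEndpoint h))
      (fun h => Or.inr (mem_anSet_of_anc hi h))

mutual
  /-- The tail of a generated arrow is a line endpoint of `H`, lies in `C ∪ an(C)`, or is
  an ancestor in `H` of the head. -/
  theorem GenArrow.tail_cases (hH : H.IsAG) {i j : V} :
      GenArrow H M (C ∪ H.anSet C) i j →
        H.LineEndpoint i ∨ i ∈ C ∪ H.anSet C ∨ H.anc i j
    | .base h => Or.inr (Or.inr (.single h))
    | .row1 _ _ h₁ h₂ => by
      have hm := GenArrow.hasHead hH.1 h₁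
      have ih₁ := GenArrow.tail_cases hH h₁
      rcases GenArrow.tail_cases hH h₂ with h | h | h
      · exact absurd hm (hH.not_hasHead_of_lineEndpoint h)
      · exact (mem_of_anc_of_hasHead hH hm ih₁ (Or.inr h)).imp_right Or.inl
      · exact ih₁.imp_right (Or.imp_right (·.trans h))
    | .row2 _ _ h _ => (GenLine.endpoint_cases hH h).1.imp_right Or.inl
    | .row3 _ _ h _ => (GenLine.endpoint_cases hH h).1.imp_right Or.inl
    | .row8 hs _ h _ =>
      (mem_of_anc_of_hasHead hH (GenArrow.hasHead hH.1 h) (GenArrow.tail_cases hH h)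
        (Or.inr hs)).imp_right Or.inl

  /-- The endpoints of a generated line are line endpoints of `H` or lie in `C ∪ an(C)`. -/
  theorem GenLine.endpoint_cases (hH : H.IsAG) {i j : V} :
      GenLine H M (C ∪ H.anSet C) i j →
        (H.LineEndpoint i ∨ i ∈ C ∪ H.anSet C) ∧ (H.LineEndpoint j ∨ j ∈ C ∪ H.anSet C)
    | .base h => ⟨Or.inl ⟨_, h⟩, Or.inl ⟨_, hH.1.2.1 _ _ h⟩⟩
    | .symm h => (GenLine.endpoint_cases hH h).symm
    | .row6 _ _ h₁ h₂ =>
      ⟨(GenLine.endpoint_cases hH h₁).1,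
        mem_of_anc_of_hasHead hH (GenArrow.hasHead hH.1 h₂) (GenArrow.tail_cases hH h₂)
          (GenLine.endpoint_cases hH h₁).2⟩
    | .row7 _ _ h₁ h₂ =>
      ⟨(GenLine.endpoint_cases hH h₁).1, (GenLine.endpoint_cases hH h₂).2⟩
    | .row10 hs _ h₁ h₂ =>
      ⟨mem_of_anc_of_hasHead hH (GenArrow.hasHead hH.1 h₁) (GenArrow.tail_cases hH h₁)
          (Or.inr hs),
        mem_of_anc_of_hasHead hH (GenArrow.hasHead hH.1 h₂) (GenArrow.tail_cases hH h₂)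
          (Or.inr hs)⟩
end

end TailEndpoints

/-! ### The summary graph -/

theorem hasHead_alphaSG {H : MixedGraph V} {M C : Set V} (hH : H.IsAG) {i : V}
    (hi : (alphaSG H M C).HasHead i) : H.HasHead i ∧ i ∉ C ∪ H.anSet C := by
  obtain ⟨k, ⟨hiA, ⟨-, hi, h⟩ | ⟨⟨-, hi, h⟩, -⟩⟩ | ⟨⟨-, hi, h⟩, -, hiA⟩⟩ := hi
  · exact ⟨h.hasHead hH.1, fun h' => h'.elim (fun hc => hi.2 (Or.inr hc)) hiA⟩
  · exact ⟨(h.hasHead hH.1).2, fun h' => h'.elim (fun hc => hi.2 (Or.inr hc)) hiA⟩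
  · exact ⟨(h.hasHead hH.1).2, fun h' => h'.elim (fun hc => hi.2 (Or.inr hc)) hiA⟩

theorem lineEndpoint_alphaSG {H : MixedGraph V} {M C : Set V} (hH : H.IsAG) {i : V}
    (hi : (alphaSG H M C).LineEndpoint i) : H.LineEndpoint i ∨ i ∈ C ∪ H.anSet C := by
  obtain ⟨j, ⟨-, -, h⟩ | ⟨-, hA⟩ | ⟨⟨-, -, h⟩, hA⟩ | ⟨-, hA, -⟩⟩ := hi
  · exact (h.endpoint_cases hH).1
  · exact Or.inr (Or.inr hA)
  · exact mem_of_anc_of_hasHead hH (h.hasHead hH.1) (h.tail_cases hH) (Or.inr (Or.inr hA))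
  · exact Or.inr (Or.inr hA)

theorem anc_of_anc_alphaSG {H : MixedGraph V} {M C : Set V} (hH : H.IsAG) {i j : V}
    (hij : (alphaSG H M C).anc i j) (hi : (alphaSG H M C).HasHead i) : H.anc i j := by
  have key : ∀ {a b : V}, (alphaSG H M C).arrow a b → (alphaSG H M C).HasHead a →
      H.anc a b := by
    intro a b hab ha
    obtain ⟨hh, hS⟩ := hasHead_alphaSG hH ha
    obtain ⟨-, ⟨-, -, h⟩ | ⟨-, hA⟩⟩ := hab
    · rcases h.tail_cases hH with h | h | h
      · exact absurd hh (hH.not_hasHead_of_lineEndpoint h)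
      · exact absurd h hS
      · exact h
    · exact absurd (Or.inr hA) hS
  induction hij with
  | single h => exact key h hi
  | tail hab hbc ih =>
    obtain ⟨c, -, hcb⟩ := Relation.TransGen.tail'_iff.1 hab
    exact ih.trans (key hbc ⟨c, Or.inl hcb⟩)

theorem isSG_alphaSG {H : MixedGraph V} {M C : Set V} (hH : H.IsAG) :
    (alphaSG H M C).IsSG := by
  have hL := hH.2.1.1
  refine ⟨⟨⟨?_, ?_, ?_⟩, ?_, ?_⟩, ?_, ?_⟩
  · rintro i j ⟨⟨hi, hj, h⟩, hiA, hjA⟩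
    exact ⟨⟨hj, hi, h.symm⟩, hjA, hiA⟩
  · rintro i j (⟨hi, hj, h⟩ | h | h | ⟨⟨hi, hj, h⟩, hiA, hjA⟩)
    · exact Or.inl ⟨hj, hi, h.symm⟩
    · exact Or.inr (Or.inr (Or.inl h))
    · exact Or.inr (Or.inl h)
    · exact Or.inr (Or.inr (Or.inr ⟨⟨hj, hi, h.symm⟩, hjA, hiA⟩))
  · rintro i j (⟨-, h | ⟨h, -⟩⟩ | ⟨h, -⟩ | h | ⟨h, -⟩ | ⟨h, -⟩ | ⟨h, -⟩)
    · exact ⟨h.1, h.2.1⟩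
    · exact ⟨h.1, h.2.1⟩
    · exact ⟨h.1, h.2.1⟩
    · exact ⟨h.1, h.2.1⟩
    · exact ⟨h.2.1, h.1⟩
    · exact ⟨h.1, h.2.1⟩
    · exact ⟨h.1, h.2.1⟩
  · refine fun i => ⟨?_, ?_, ?_⟩
    · rintro ⟨-, h | ⟨h, -⟩⟩
      · exact h.2.2.ne hL rfl
      · exact h.2.2.ne hL rfl
    · rintro ⟨h, -⟩
      exact h.2.2.ne hL rfl
    · rintro (h | ⟨h, -⟩ | ⟨h, -⟩ | ⟨h, -⟩)
      · exact h.2.2.ne hL rfl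
      · exact h.2.2.ne hL rfl
      · exact h.2.2.ne hL rfl
      · exact h.2.2.ne hL rfl
  · exact hH.2.2.1.subset Set.sdiff_subset
  · intro i hi k
    have hn : ¬ (alphaSG H M C).HasHead i := fun hh => by
      obtain ⟨h, hS⟩ := hasHead_alphaSG hH hh
      exact (lineEndpoint_alphaSG hH hi).elim
        (fun hl => hH.not_hasHead_of_lineEndpoint hl h) hS
    exact ⟨fun h => hn ⟨k, Or.inl h⟩, fun h => hn ⟨k, Or.inr h⟩⟩
  · intro i h
    obtain ⟨c, -, hc⟩ := Relation.TransGen.tail'_iff.1 h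
    exact hH.not_anc_self i (anc_of_anc_alphaSG hH h ⟨c, Or.inl hc⟩)

/-! ### From summary graphs to ancestral graphs -/

mutual
  theorem AG2Arrow.anc {K : MixedGraph V} {i j : V} : AG2Arrow K i j → K.anc i j
    | .base h => .single h
    | .gen _ h _ h' => (AG2Arrow.anc h).trans (AG2Anc.anc h')

  theorem AG2Anc.anc {K : MixedGraph V} {i j : V} : AG2Anc K i j → K.anc i j
    | .single h => AG2Arrow.anc h
    | .tail h h' => (AG2Arrow.anc h).trans (AG2Anc.anc h')
end

theorem AG2Arc.ne {K : MixedGraph V} (hL : K.Loopless) {i j : V} (h : AG2Arc K i j) :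
    i ≠ j :=
  match h with
  | .base h => by rintro rfl; exact (hL _).2.1 h
  | .symm h => (AG2Arc.ne hL h).symm
  | .gen h _ _ _ => h

theorem AG2Arc.hasHead {K : MixedGraph V} (hW : K.Wf) {i j : V} (h : AG2Arc K i j) :
    K.HasHead i ∧ K.HasHead j :=
  match h with
  | .base h => ⟨⟨_, Or.inr (hW.1 _ _ h)⟩, ⟨_, Or.inr h⟩⟩
  | .symm h => (AG2Arc.hasHead hW h).symm
  | .gen _ h₁ h₂ _ => ⟨(AG2Arc.hasHead hW h₁).1, (AG2Arc.hasHead hW h₂).2⟩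

theorem AG2Arrow.hasHead {K : MixedGraph V} (hW : K.Wf) {i j : V} (h : AG2Arrow K i j) :
    K.HasHead j :=
  match h with
  | .base h => ⟨_, Or.inl h⟩
  | .gen _ _ h _ => (h.hasHead hW).2

mutual
  theorem AG3Arrow.anc {K : MixedGraph V} {i j : V} : AG3Arrow K i j → K.anc i j
    | .base h => .single h
    | .conv _ h => AG3Anc.anc h

  theorem AG3Anc.anc {K : MixedGraph V} {i j : V} : AG3Anc K i j → K.anc i j
    | .single h => AG3Arrow.anc h
    | .tail h h' => (AG3Arrow.anc h).trans (AG3Anc.anc h')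
end

theorem AG3Arrow.hasHead {K : MixedGraph V} {i j : V} (h : AG3Arrow K i j) :
    K.HasHead j :=
  match h with
  | .base h => ⟨_, Or.inl h⟩
  | .conv h _ => ⟨_, Or.inr h⟩

theorem anc_of_anc_ag2 {K : MixedGraph V} {i j : V} (h : (ag2 K).anc i j) : K.anc i j := by
  induction h with
  | single h => exact AG2Arrow.anc h
  | tail _ h ih => exact ih.trans (AG2Arrow.anc h)

theorem hasHead_of_hasHead_ag2 {K : MixedGraph V} (hW : K.Wf) {i : V}
    (h : (ag2 K).HasHead i) : K.HasHead i := by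
  obtain ⟨k, h | h⟩ := h
  · exact AG2Arrow.hasHead hW h
  · exact (AG2Arc.hasHead hW h).2

theorem MixedGraph.Wf.mem_of_hasHead {K : MixedGraph V} (hW : K.Wf) {i : V}
    (h : K.HasHead i) : i ∈ K.nodes := by
  obtain ⟨k, h⟩ := h
  exact (hW.2.2 k i (h.imp_right Or.inl)).2

theorem MixedGraph.Wf.mem_of_anc {K : MixedGraph V} (hW : K.Wf) {i j : V}
    (h : K.anc i j) : i ∈ K.nodes := by
  obtain ⟨k, h, -⟩ := Relation.TransGen.head'_iff.1 h
  exact (hW.2.2 i k (Or.inl h)).1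

theorem ag3Anc_of_anc_alphaSGAG {K : MixedGraph V} {i j : V}
    (h : (alphaSGAG K).anc i j) : AG3Anc (ag2 K) i j := by
  induction h using Relation.TransGen.head_induction_on with
  | single h => exact .single h
  | head h _ ih => exact .tail h ih

theorem isAG_alphaSGAG {K : MixedGraph V} (hK : K.IsSG) : (alphaSGAG K).IsAG := by
  obtain ⟨⟨hW, hL, hF⟩, hE, hA⟩ := hK
  have arrow_anc : ∀ {i j}, (alphaSGAG K).arrow i j → K.anc i j :=
    fun h => anc_of_anc_ag2 (AG3Arrow.anc h)
  have arrow_head : ∀ {i j}, (alphaSGAG K).arrow i j → K.HasHead j :=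
    fun h => hasHead_of_hasHead_ag2 hW (AG3Arrow.hasHead h)
  have arc_head : ∀ {i j}, (alphaSGAG K).arc i j → K.HasHead i ∧ K.HasHead j :=
    fun h => AG2Arc.hasHead hW h.1
  have line_head : ∀ {i j}, K.line i j → ¬ K.HasHead i := by
    rintro i j h ⟨k, hk⟩
    exact hk.elim (hE i ⟨j, h⟩ k).1 (hE i ⟨j, h⟩ k).2
  refine ⟨⟨?_, hW.2.1, ?_⟩, ⟨?_, ?_⟩, hF, ?_, ?_⟩
  · exact fun i j ⟨h, h₁, h₂⟩ => ⟨AG2Arc.symm h, h₂, h₁⟩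
  · rintro i j (h | h | h)
    · exact ⟨hW.mem_of_anc (arrow_anc h), hW.mem_of_hasHead (arrow_head h)⟩
    · exact ⟨hW.mem_of_hasHead (arc_head h).1, hW.mem_of_hasHead (arc_head h).2⟩
    · exact hW.2.2 i j (Or.inr (Or.inr h))
  · exact fun i => ⟨fun h => hA i (arrow_anc h), fun h => AG2Arc.ne hL h.1 rfl, (hL i).2.2⟩
  · refine fun i j => ⟨fun h => ⟨?_, ?_, ?_⟩, ?_⟩
    · exact fun h' => hA i ((arrow_anc h).trans (arrow_anc h'))
    · exact fun h' => h'.2.1 (.single h)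
    · exact fun h' => line_head (hW.2.1 _ _ h') (arrow_head h)
    · exact fun h h' => line_head h' (arc_head h).1
  · rintro i j (h | h) hij
    · exact hA i ((anc_of_anc_ag2 (AG3Anc.anc (ag3Anc_of_anc_alphaSGAG hij))).trans
        (arrow_anc h))
    · exact h.2.2 (ag3Anc_of_anc_alphaSGAG hij)
  · rintro i ⟨j, hj⟩ k
    exact ⟨fun h => line_head hj (arrow_head h), fun h => line_head hj (arc_head h).2⟩

/-- (Proposition 6) For every ancestral graph `H` and
disjoint subsets `M` and `C` of its node set, the generated graph
`α_AG(H;M,C)` is an ancestral graph. -/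
theorem stmt_15 {V : Type} (H : MixedGraph V) (M C : Set V)
    (hH : H.IsAG) (hM : M ⊆ H.nodes) (hC : C ⊆ H.nodes) (hMC : Disjoint M C) :
    (alphaAG H M C).IsAG := by
  exact isAG_alphaSGAG (isSG_alphaSG hH)

end StableMixedGraphs
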